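/- If w is a nonempty word such that ww is a factor of the Tribonacci word 𝕋, then there exists m≥0 such that |w|=t_m or |w|=t_m+t_{m-1}. Conversely, for every m≥0 there exist nonempty words u and v with |u|=t_m, |v|=t_m+t_{m-1}, such that uu and vv are factors of 𝕋. -/

import Mathlib

/-- The three-letter alphabet of the Tribonacci word. -/
inductive TLetter : Type
  | a | b | c
deriving DecidableEq

/-- The Tribonacci substitution σ(a)=ab, σ(b)=ac, σ(c)=a. -/
def tsubst : TLetter → List TLetter
  | .a => [.a, .b]
  | .b => [.a, .c]
  | .c => [.a]

/-- `Tword m = σ^m(a)`, the m-th finite Tribonacci word. -/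
def Tword : ℕ → List TLetter
  | 0 => [.a]
  | n + 1 => (Tword n).flatMap tsubst

/-- The prefix 𝕋[1,n] of the Tribonacci word of length n
(each `Tword n` is a prefix of the next and has length ≥ n). -/
def TPrefix (n : ℕ) : List TLetter := (Tword n).take n

/-- A word is a factor of the Tribonacci word 𝕋. -/
def IsFactorT (w : List TLetter) : Prop := ∃ m, w <:+: Tword m

/-- `tribAux i = t_{i-2}`: Tribonacci numbers, shifted so that the index is a natural. -/
def tribAux : ℕ → ℕ
  | 0 => 0
  | 1 => 1
  | 2 => 1
  | n + 3 => tribAux (n + 2) + tribAux (n + 1) + tribAux n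

/-- The Tribonacci numbers `t m` for `m : ℤ`: t₋₂=0, t₋₁=1, t₀=1,
`t m = t (m-1) + t (m-2) + t (m-3)` for m ≥ 1. (Junk value 0 below -2.) -/
def t (m : ℤ) : ℕ := tribAux (m + 2).toNat

/-- Kernel numbers: k₀=0, k₁=k₂=1, `k m = k (m-1) + k (m-2) + k (m-3) - 1` for m ≥ 3. -/
def kAux : ℕ → ℕ
  | 0 => 0
  | 1 => 1
  | 2 => 1
  | n + 3 => kAux (n + 2) + kAux (n + 1) + kAux n - 1

def kker (m : ℤ) : ℕ := kAux m.toNat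

/-- `A n`: the number of distinct nonempty words w with ww a factor of 𝕋[1,n]. -/
noncomputable def A (n : ℕ) : ℕ := Nat.card {w : List TLetter // w ≠ [] ∧ (w ++ w) <:+: TPrefix n}

/-- `B n`: the number of occurrences of squares in 𝕋[1,n], i.e. of pairs (w,i) with
w nonempty, i ≥ 1, ww occurring in 𝕋 at position i and i + 2|w| - 1 ≤ n. -/
noncomputable def B (n : ℕ) : ℕ :=
  Nat.card {p : List TLetter × ℕ // p.1 ≠ [] ∧ 1 ≤ p.2 ∧
    p.2 + 2 * p.1.length - 1 ≤ n ∧ (p.1 ++ p.1) <+: (TPrefix n).drop (p.2 - 1)}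

/-- `C n`: the number of distinct nonempty words w with www a factor of 𝕋[1,n]. -/
noncomputable def C (n : ℕ) : ℕ := Nat.card {w : List TLetter // w ≠ [] ∧ (w ++ w ++ w) <:+: TPrefix n}

/-- `D n`: the number of occurrences of cubes in 𝕋[1,n], i.e. of pairs (w,i) with
w nonempty, i ≥ 1, www occurring in 𝕋 at position i and i + 3|w| - 1 ≤ n. -/
noncomputable def D (n : ℕ) : ℕ :=
  Nat.card {p : List TLetter × ℕ // p.1 ≠ [] ∧ 1 ≤ p.2 ∧
    p.2 + 3 * p.1.length - 1 ≤ n ∧ (p.1 ++ p.1 ++ p.1) <+: (TPrefix n).drop (p.2 - 1)}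

/-- The `n`-fold application of the Tribonacci substitution to a word. -/
def tsubstIter : ℕ → List TLetter → List TLetter
  | 0, w => w
  | n + 1, w => tsubstIter n (w.flatMap tsubst)

theorem tsubstIter_append (n : ℕ) (v w : List TLetter) :
    tsubstIter n (v ++ w) = tsubstIter n v ++ tsubstIter n w := by
  induction n generalizing v w with
  | zero => rfl
  | succ n ih => simp [tsubstIter, ih]

theorem tsubstIter_flatMap (n : ℕ) (w : List TLetter) :
    tsubstIter n (w.flatMap tsubst) = (tsubstIter n w).flatMap tsubst := by
  induction n generalizing w with
  | zero => rfl
  | succ n ih => simp only [tsubstIter, ih]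

theorem length_tsubstIter_letters (n : ℕ) :
    (tsubstIter n [.a]).length = tribAux (n + 2) ∧
      (tsubstIter n [.b]).length = tribAux (n + 1) + tribAux n ∧
      (tsubstIter n [.c]).length = tribAux (n + 1) := by
  induction n with
  | zero => decide
  | succ n ih =>
    obtain ⟨ha, hb, hc⟩ := ih
    have key (x y : TLetter) : tsubstIter n [x, y] = tsubstIter n [x] ++ tsubstIter n [y] :=
      tsubstIter_append n [x] [y]
    refine ⟨?_, ?_, ?_⟩ <;> simp [tsubstIter, tsubst, key, ha, hb, hc, tribAux]; ring

theorem tsubstIter_Tword (n k : ℕ) : tsubstIter n (Tword k) = Tword (k + n) := by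
  induction n generalizing k with
  | zero => rfl
  | succ n ih =>
    have h := ih (k + 1)
    rw [Nat.add_right_comm] at h
    exact h

theorem IsFactorT.tsubstIter {w : List TLetter} (h : IsFactorT w) (n : ℕ) :
    IsFactorT (tsubstIter n w) := by
  obtain ⟨k, s, r, hk⟩ := h
  exact ⟨k + n, _root_.tsubstIter n s, _root_.tsubstIter n r, by
    rw [← tsubstIter_append, ← tsubstIter_append, hk, tsubstIter_Tword]⟩

/-- Every occurrence of `a` in a substituted word starts the image of a letter. -/
theorem flatMap_tsubst_eq_append_a_cons {L s q : List TLetter}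
    (h : L.flatMap tsubst = s ++ .a :: q) :
    ∃ L₁ L₂, L = L₁ ++ L₂ ∧ L₁.flatMap tsubst = s ∧ L₂.flatMap tsubst = .a :: q := by
  induction L generalizing s with
  | nil => simp at h
  | cons y L ih =>
    rcases s with _ | ⟨d, s⟩
    · exact ⟨[], y :: L, rfl, rfl, h⟩
    · rcases y with _ | _ | _
      · rcases s with _ | ⟨e, s⟩
        · simp [tsubst] at h
        · simp only [List.flatMap_cons, tsubst, List.cons_append, List.nil_append,
            List.cons.injEq] at h
          obtain ⟨rfl, rfl, h⟩ := h
          obtain ⟨L₁, L₂, rfl, rfl, h₂⟩ := ih h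
          exact ⟨.a :: L₁, L₂, rfl, rfl, h₂⟩
      · rcases s with _ | ⟨e, s⟩
        · simp [tsubst] at h
        · simp only [List.flatMap_cons, tsubst, List.cons_append, List.nil_append,
            List.cons.injEq] at h
          obtain ⟨rfl, rfl, h⟩ := h
          obtain ⟨L₁, L₂, rfl, rfl, h₂⟩ := ih h
          exact ⟨.b :: L₁, L₂, rfl, rfl, h₂⟩
      · simp only [List.flatMap_cons, tsubst, List.cons_append, List.nil_append,
          List.cons.injEq] at h
        obtain ⟨rfl, h⟩ := h
        obtain ⟨L₁, L₂, rfl, rfl, h₂⟩ := ih h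
        exact ⟨.c :: L₁, L₂, rfl, rfl, h₂⟩

/-- Every letter other than `a` in a substituted word is preceded by `a`. -/
theorem exists_eq_append_a_of_flatMap_tsubst {L s q : List TLetter} {d : TLetter}
    (hd : d ≠ .a) (h : L.flatMap tsubst = s ++ d :: q) : ∃ s', s = s' ++ [.a] := by
  induction L generalizing s with
  | nil => simp at h
  | cons y L ih =>
    rcases s with _ | ⟨e, s⟩
    · rcases y with _ | _ | _ <;> (simp [tsubst] at h; exact absurd h.1.symm hd)
    · rcases y with _ | _ | _
      · rcases s with _ | ⟨f, s⟩
        · simp only [List.flatMap_cons, tsubst, List.cons_append, List.cons.injEq] at h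
          exact ⟨[], by simp [← h.1]⟩
        · simp only [List.flatMap_cons, tsubst, List.cons_append, List.nil_append,
            List.cons.injEq] at h
          obtain ⟨s', rfl⟩ := ih h.2.2
          exact ⟨e :: f :: s', rfl⟩
      · rcases s with _ | ⟨f, s⟩
        · simp only [List.flatMap_cons, tsubst, List.cons_append, List.cons.injEq] at h
          exact ⟨[], by simp [← h.1]⟩
        · simp only [List.flatMap_cons, tsubst, List.cons_append, List.nil_append,
            List.cons.injEq] at h
          obtain ⟨s', rfl⟩ := ih h.2.2
          exact ⟨e :: f :: s', rfl⟩
      · simp only [List.flatMap_cons, tsubst, List.cons_append, List.nil_append,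
          List.cons.injEq] at h
        obtain ⟨s', rfl⟩ := ih h.2
        exact ⟨e :: s', rfl⟩

theorem flatMap_tsubst_eq_nil_iff {L : List TLetter} : L.flatMap tsubst = [] ↔ L = [] := by
  rcases L with _ | ⟨_ | _ | _, L⟩ <;> simp [tsubst]

theorem flatMap_tsubst_head {L : List TLetter} {d : TLetter} {q : List TLetter}
    (h : L.flatMap tsubst = d :: q) : d = .a := by
  rcases L with _ | ⟨_ | _ | _, L⟩ <;> simp [tsubst] at h <;> exact h.1.symm

theorem flatMap_tsubst_injective :
    Function.Injective fun L : List TLetter ↦ L.flatMap tsubst := by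
  intro L
  induction L with
  | nil => exact fun M h ↦ (flatMap_tsubst_eq_nil_iff.1 h.symm).symm
  | cons x L ih =>
    rintro (_ | ⟨y, M⟩) h
    · exact flatMap_tsubst_eq_nil_iff.1 h
    · rcases x with _ | _ | _ <;> rcases y with _ | _ | _ <;>
        simp only [List.flatMap_cons, tsubst, List.cons_append, List.nil_append,
          List.cons.injEq, true_and, reduceCtorEq, false_and] at h
      · rw [ih h]
      · exact absurd (flatMap_tsubst_head h.symm) (by decide)
      · rw [ih h]
      · exact absurd (flatMap_tsubst_head h.symm) (by decide)
      · exact absurd (flatMap_tsubst_head h) (by decide)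
      · exact absurd (flatMap_tsubst_head h) (by decide)
      · rw [ih h]

theorem not_cc_infix_Tword (m : ℕ) : ¬ [.c, .c] <:+: Tword m := by
  rintro ⟨s, q, h⟩
  cases m with
  | zero =>
    have hl := congrArg List.length h
    simp [Tword] at hl
    omega
  | succ m =>
    have h' : (Tword m).flatMap tsubst = (s ++ [.c]) ++ .c :: q := by
      rw [← Tword, ← h]; simp
    obtain ⟨s', hs⟩ := exists_eq_append_a_of_flatMap_tsubst (by decide) h'
    simpa using List.append_inj_right' hs rfl

/-- Desubstitution of a repetition `u x u` with `u` starting with `a`. -/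
theorem exists_desubstitution_of_a_cons {L u s r : List TLetter} {x : TLetter}
    (hcc : ¬ [.c, .c] <:+: L)
    (h : L.flatMap tsubst = s ++ (.a :: u ++ x :: .a :: u) ++ r) :
    ∃ v y, (v ++ y :: v) <:+: L ∧ (v ++ [y]).flatMap tsubst = .a :: u ++ [x] := by
  obtain ⟨L₁, L₂, rfl, -, h₂⟩ :=
    flatMap_tsubst_eq_append_a_cons (q := u ++ x :: .a :: u ++ r) (s := s) (by simpa using h)
  obtain ⟨V, L₃, rfl, hV, h₃⟩ :=
    flatMap_tsubst_eq_append_a_cons (q := u ++ r) (s := .a :: u ++ [x]) (by simpa using h₂)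
  rcases V.eq_nil_or_concat with rfl | ⟨v, y, rfl⟩
  · simp at hV
  simp only [List.concat_eq_append] at *
  refine ⟨v, y, ?_, hV⟩
  suffices hv : v <+: L₃ by
    obtain ⟨L₄, rfl⟩ := hv
    exact ⟨L₁, L₄, by simp⟩
  have prefix_of_a : ∀ q, L₃.flatMap tsubst = v.flatMap tsubst ++ .a :: q → v <+: L₃ := by
    intro q hq
    obtain ⟨L₄, L₅, rfl, h₄, -⟩ := flatMap_tsubst_eq_append_a_cons hq
    rw [flatMap_tsubst_injective h₄]
    exact List.prefix_append _ _
  have prefix_of_pair : ∀ d, v.flatMap tsubst ++ [.a, d] = .a :: u ++ [x] → v <+: L₃ := by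
    intro d hd
    have := List.append_inj_left' (s₁ := v.flatMap tsubst ++ [.a]) (t₁ := [d])
      (s₂ := .a :: u) (t₂ := [x]) (by simpa using hd) rfl
    refine prefix_of_a r ?_
    rw [h₃, ← List.cons_append, ← this]
    simp
  rcases y with _ | _ | _
  · exact prefix_of_pair .b (by simpa [tsubst] using hV)
  · exact prefix_of_pair .c (by simpa [tsubst] using hV)
  · have hu : v.flatMap tsubst = .a :: u :=
      List.append_inj_left' (t₁ := [.a]) (t₂ := [x]) (by simpa [tsubst] using hV) rfl
    rw [← List.cons_append, ← hu] at h₃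
    rcases r with _ | ⟨d, r⟩
    · rw [List.append_nil] at h₃
      rw [flatMap_tsubst_injective h₃]
    · by_cases hd : d = .a
      · subst hd
        exact prefix_of_a r h₃
      · obtain ⟨s', hs⟩ := exists_eq_append_a_of_flatMap_tsubst hd h₃
        obtain ⟨V₁, V₂, rfl, -, hV₂⟩ := flatMap_tsubst_eq_append_a_cons hs
        have hV₂c : V₂ = [.c] := flatMap_tsubst_injective (a₂ := [.c]) (by simpa [tsubst] using hV₂)
        subst hV₂c
        exact absurd ⟨L₁ ++ V₁, L₃, by simp⟩ hcc

/-- Desubstitution of a repetition `u x u` with `u` nonempty, up to conjugacy of `u x`. -/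
theorem exists_desubstitution {L u : List TLetter} {x : TLetter} (hu : u ≠ [])
    (hcc : ¬ [.c, .c] <:+: L) (h : (u ++ x :: u) <:+: L.flatMap tsubst) :
    ∃ v y, (v ++ y :: v) <:+: L ∧ ((v ++ [y]).flatMap tsubst).Perm (u ++ [x]) := by
  obtain ⟨s, r, h⟩ := h
  obtain ⟨d, u, rfl⟩ := List.exists_cons_of_ne_nil hu
  by_cases hd : d = .a
  · subst hd
    obtain ⟨v, y, hv, hp⟩ := exists_desubstitution_of_a_cons hcc h.symm
    exact ⟨v, y, hv, .of_eq hp⟩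
  · obtain ⟨s', rfl⟩ := exists_eq_append_a_of_flatMap_tsubst (L := L) (s := s)
      (q := u ++ x :: d :: u ++ r) hd (by simp [← h])
    obtain ⟨p, hp⟩ := exists_eq_append_a_of_flatMap_tsubst (L := L) (s := s' ++ .a :: d :: u ++ [x])
      (q := u ++ r) hd (by simp [← h])
    obtain rfl : x = .a := by simpa using List.append_inj_right' hp rfl
    rcases u.eq_nil_or_concat with rfl | ⟨w, e, rfl⟩
    · obtain ⟨v, y, hv, hp⟩ := exists_desubstitution_of_a_cons (u := []) (x := d)
        (s := s') (r := d :: r) hcc (by simp [← h])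
      exact ⟨v, y, hv, (List.Perm.of_eq hp).trans (.swap _ _ _)⟩
    · obtain ⟨v, y, hv, hp⟩ := exists_desubstitution_of_a_cons (u := d :: w) (x := e)
        (s := s') (r := e :: r) hcc (by simp [← h])
      refine ⟨v, y, hv, (List.Perm.of_eq hp).trans ?_⟩
      simpa using (List.perm_append_comm (l₁ := [.a]) (l₂ := d :: w ++ [e]))

/-- The period `u x` of a factor `u x u` of a finite Tribonacci word is a rearrangement of an
iterated image of a letter. -/
theorem exists_perm_tsubstIter_of_infix_Tword {m : ℕ} {u : List TLetter} {x : TLetter}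
    (h : (u ++ x :: u) <:+: Tword m) : ∃ n y, (tsubstIter n [y]).Perm (u ++ [x]) := by
  induction m generalizing u x with
  | zero =>
    have hl := h.length_le
    simp only [Tword, List.length_append, List.length_cons, List.length_nil] at hl
    obtain rfl : u = [] := List.eq_nil_of_length_eq_zero (by omega)
    exact ⟨0, x, .refl _⟩
  | succ m ih =>
    by_cases hu : u = []
    · subst hu
      exact ⟨0, x, .refl _⟩
    obtain ⟨v, y, hv, hp⟩ := exists_desubstitution hu (not_cc_infix_Tword m) h
    obtain ⟨n, z, hz⟩ := ih hv
    refine ⟨n + 1, z, ?_⟩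
    rw [tsubstIter, tsubstIter_flatMap]
    exact (hz.flatMap_right _).trans hp

theorem t_natCast (n : ℕ) : t n = tribAux (n + 2) := rfl

theorem t_natCast_sub_one (n : ℕ) : t ((n : ℤ) - 1) = tribAux (n + 1) := by
  rw [t]
  congr 1
  omega

theorem square_lengths :
    (∀ w : List TLetter, w ≠ [] → IsFactorT (w ++ w) →
      ∃ m : ℤ, 0 ≤ m ∧ (w.length = t m ∨ w.length = t m + t (m - 1))) ∧
    (∀ m : ℤ, 0 ≤ m →
      (∃ u : List TLetter, u ≠ [] ∧ u.length = t m ∧ IsFactorT (u ++ u)) ∧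
      (∃ v : List TLetter, v ≠ [] ∧ v.length = t m + t (m - 1) ∧ IsFactorT (v ++ v))) := by
  refine ⟨fun w hw ⟨k, hk⟩ ↦ ?_, fun m hm ↦ ?_⟩
  · rcases w.eq_nil_or_concat with rfl | ⟨u, x, rfl⟩
    · exact absurd rfl hw
    obtain ⟨n, y, hp⟩ := exists_perm_tsubstIter_of_infix_Tword (u := u) (x := x)
      (List.IsInfix.trans ⟨[], [x], by simp⟩ hk)
    rw [List.concat_eq_append, ← hp.length_eq]
    obtain ⟨ha, hb, hc⟩ := length_tsubstIter_letters n
    rcases y with _ | _ | _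
    · exact ⟨n, by positivity, .inl (by rw [ha, t_natCast])⟩
    · rcases n with _ | n
      · exact ⟨0, le_rfl, .inl rfl⟩
      · exact ⟨n, by positivity, .inr (by rw [hb, t_natCast, t_natCast_sub_one])⟩
    · rcases n with _ | n
      · exact ⟨0, le_rfl, .inl rfl⟩
      · exact ⟨n, by positivity, .inl (by rw [hc, t_natCast])⟩
  · lift m to ℕ using hm
    have exists_square (v : List TLetter) (n : ℕ) (hv : IsFactorT (v ++ v))
        (hpos : 0 < (tsubstIter n v).length) :
        ∃ u : List TLetter, u ≠ [] ∧ u.length = (tsubstIter n v).length ∧ IsFactorT (u ++ u) :=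
      ⟨tsubstIter n v, List.length_pos_iff.1 hpos, rfl, by
        rw [← tsubstIter_append]; exact hv.tsubstIter n⟩
    have tribAux_pos (n : ℕ) : 0 < tribAux (n + 1) := by
      induction n using Nat.strong_induction_on with
      | _ n ih =>
        rcases n with _ | _ | n
        · decide
        · decide
        · have : 0 < tribAux (n + 2) := ih (n + 1) (by omega)
          simp only [tribAux]
          omega
    rw [t_natCast, t_natCast_sub_one]
    constructor
    · obtain ⟨ha, -, -⟩ := length_tsubstIter_letters m
      rw [← ha]
      exact exists_square _ _ ⟨4, by decide⟩ (ha ▸ tribAux_pos _)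
    · rcases m with _ | n
      · exact exists_square [.a, .b] 0 ⟨5, by decide⟩ (by decide)
      · obtain ⟨ha, hb, -⟩ := length_tsubstIter_letters n
        have hl : (tsubstIter n [.a, .b, .a]).length = tribAux (n + 1 + 2) + tribAux (n + 1 + 1) := by
          rw [show [TLetter.a, .b, .a] = [.a] ++ ([.b] ++ [.a]) from rfl, tsubstIter_append,
            tsubstIter_append, List.length_append, List.length_append, ha, hb]
          simp only [tribAux]
          ring
        rw [← hl]
        exact exists_square _ _ ⟨5, by decide⟩ (by rw [hl]; have := tribAux_pos (n + 1); omega)
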